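/- Let n ≥ 1 and 0 ≤ t ≤ s be integers. Then the t-fold Verschiebung V^t : W_{s-t}(K) → W_s(K) maps fil_n W_{s-t}(K) into fil_n W_s(K), the truncation pr_t maps fil_n W_s(K) onto fil^{(s-t)}_n W_t(K), and the induced sequence of abelian groups 0 → fil_n W_{s-t}(K)/fil_{n-1} W_{s-t}(K) → fil_n W_s(K)/fil_{n-1} W_s(K) → fil^{(s-t)}_n W_t(K)/fil^{(s-t)}_{n-1} W_t(K) → 0 is exact. Moreover, the right-hand quotient equals fil_{n/p^{s-t}} W_t(K)/fil_{n/p^{s-t}-1} W_t(K) if p^{s-t} divides n, and is 0 otherwise. -/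

import Mathlib

/-!
Setting: `K` is a (complete) discrete valuation field of characteristic `p > 0`, with
normalized additive valuation `v = ord_K : K → ℤ ∪ {∞}` (normalization is expressed by
the existence of a uniformizer `π` with `v π = 1`).

`W_s(K)` is the ring of `p`-typical Witt vectors of length `s` over `K`.  Following the
paper, a Witt vector is written `a = (a_{s-1}, …, a_0)`, where the paper's component
`a_i` is the component of standard index `s - 1 - i` (so `a_{s-1}` is the leading
component and the Verschiebung `V` sends `(a_{s-1}, …, a_0)` to `(0, a_{s-1}, …, a_0)`,
i.e. it is the standard index shift).  We realize `W_s(K)` as `TruncatedWittVector p s K`.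
-/

noncomputable section

open TruncatedWittVector

variable (p : ℕ) [Fact p.Prime] (K : Type*) [Field K] [CharP K p]
variable (v : AddValuation K (WithTop ℤ))

/-- The Frobenius `F : W_s(K) → W_s(K)`, raising each component to the `p`-th power. -/
def frobW {s : ℕ} (a : TruncatedWittVector p s K) : TruncatedWittVector p s K :=
  TruncatedWittVector.mk p fun i => a.coeff i ^ p

/-- The `k`-fold Verschiebung `V^k : W_t(K) → W_s(K)` (for `t + k = s`), shifting
components: in the paper's notation it sends `(a_{t-1}, …, a_0)` to
`(0, …, 0, a_{t-1}, …, a_0)`. -/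
def VShift (k : ℕ) {t : ℕ} (s : ℕ) (a : TruncatedWittVector p t K) :
    TruncatedWittVector p s K :=
  TruncatedWittVector.mk p fun i =>
    if h : k ≤ (i : ℕ) ∧ (i : ℕ) - k < t then a.coeff ⟨(i : ℕ) - k, h.2⟩ else 0

/-- The truncation `pr_t : W_s(K) → W_t(K)`, `(a_{s-1}, …, a_0) ↦ (a_{s-1}, …, a_{s-t})`. -/
def prW {s : ℕ} (t : ℕ) (ht : t ≤ s) (a : TruncatedWittVector p s K) :
    TruncatedWittVector p t K :=
  TruncatedWittVector.mk p fun i => a.coeff (Fin.castLE ht i)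

/-- `ord_K(a) = min_{0 ≤ i ≤ s-1} p^i · ord_K(a_i)` for a Witt vector
`a = (a_{s-1}, …, a_0) ∈ W_s(K)` (the paper's component `a_i` has standard index
`s - 1 - i`, whence the weight `p ^ (s - 1 - i)` below). -/
def wittOrd {s : ℕ} (a : TruncatedWittVector p s K) : WithTop ℤ :=
  Finset.univ.inf fun i : Fin s => p ^ (s - 1 - (i : ℕ)) • v (a.coeff i)

/-- Brylinski--Kato filtration `fil_n W_s(K) = {a ∈ W_s(K) | ord_K(a) ≥ -n}`. -/
def filW (s : ℕ) (n : ℤ) : Set (TruncatedWittVector p s K) :=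
  {a | ((-n : ℤ) : WithTop ℤ) ≤ wittOrd p K v a}

/-- `fil^{(r)}_n W_s(K) = fil_{[n/p^r]} W_s(K)` (for `n ≥ 0`). -/
def filWr (s r : ℕ) (n : ℕ) : Set (TruncatedWittVector p s K) :=
  filW p K v s ((n / p ^ r : ℕ) : ℤ)

/-- Matsuda's filtration
`fil'_m W_s(K) = fil_{m-1} W_s(K) + V^{s-s'}(fil_m W_{s'}(K))`, `s' = min(ord_p m, s)`. -/
def filW' (s m : ℕ) : Set (TruncatedWittVector p s K) :=
  {a | ∃ b ∈ filW p K v s ((m : ℤ) - 1),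
      ∃ c ∈ filW p K v (min (padicValNat p m) s) (m : ℤ),
        a = b + VShift p K (s - min (padicValNat p m) s) s c}

/-- `fil'^{(r)}_m W_s(K) = fil^{(r)}_{m-1} W_s(K) + V^{s-s''}(fil^{(r)}_m W_{s''}(K))`,
where `s'' = max(0, min(ord_p m, s + r) - r)`. -/
def filW'r (s r m : ℕ) : Set (TruncatedWittVector p s K) :=
  {a | ∃ b ∈ filWr p K v s r (m - 1),
      ∃ c ∈ filWr p K v (min (padicValNat p m) (s + r) - r) r m,
        a = b + VShift p K (s - (min (padicValNat p m) (s + r) - r)) s c}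

/-- `fil''^{(r)}_m W_s(K) = fil^{(r)}_{[(m-1)/p]} W_s(K) + V^{s-s''}(fil^{(r)}_{[m/p]} W_{s''}(K))`,
where `s'' = max(0, min(ord_p m, s + r) - r)`. -/
def filW''r (s r m : ℕ) : Set (TruncatedWittVector p s K) :=
  {a | ∃ b ∈ filWr p K v s r ((m - 1) / p),
      ∃ c ∈ filWr p K v (min (padicValNat p m) (s + r) - r) r (m / p),
        a = b + VShift p K (s - (min (padicValNat p m) (s + r) - r)) s c}

/-- `fil''_m W_s(K) = fil''^{(0)}_m W_s(K)
  = fil_{[(m-1)/p]} W_s(K) + V^{s-s'}(fil_{[m/p]} W_{s'}(K))`. -/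
def filW'' (s m : ℕ) : Set (TruncatedWittVector p s K) :=
  filW''r p K v s 0 m

section BrylinskiKato

variable {p K v}

omit [CharP K p]

omit [Fact p.Prime] in
theorem mem_filW_iff {s : ℕ} {n : ℤ} {a : TruncatedWittVector p s K} :
    a ∈ filW p K v s n ↔
      ∀ i : Fin s, ((-n : ℤ) : WithTop ℤ) ≤ p ^ (s - 1 - (i : ℕ)) • v (a.coeff i) := by
  simp [filW, wittOrd, Finset.le_inf_iff]

theorem WithTop.nsmul_top_of_pos {k : ℕ} (hk : 0 < k) : k • (⊤ : WithTop ℤ) = ⊤ := by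
  obtain ⟨m, rfl⟩ := Nat.exists_eq_add_of_lt hk
  rw [zero_add, succ_nsmul, WithTop.add_top]

theorem neg_le_mul_nsmul_iff {q c : ℕ} (hq : 0 < q) (hc : 0 < c) (n : ℕ) (x : WithTop ℤ) :
    ((-(n : ℤ) : ℤ) : WithTop ℤ) ≤ (q * c) • x ↔
      ((-((n / q : ℕ) : ℤ) : ℤ) : WithTop ℤ) ≤ c • x := by
  induction x using WithTop.recTopCoe with
  | top => simp only [WithTop.nsmul_top_of_pos (Nat.mul_pos hq hc), WithTop.nsmul_top_of_pos hc,
      le_top]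
  | coe m =>
    rw [← WithTop.coe_nsmul, ← WithTop.coe_nsmul, WithTop.coe_le_coe, WithTop.coe_le_coe,
      mul_nsmul', nsmul_eq_mul, neg_le, neg_le (b := c • m), Int.natCast_div,
      Int.le_ediv_iff_mul_le (by exact_mod_cast hq)]
    rw [neg_mul, mul_comm]

theorem neg_le_pow_nsmul_zero (k : ℕ) (n : ℤ) :
    ((n : ℤ) : WithTop ℤ) ≤ p ^ k • v (0 : K) := by
  rw [AddValuation.map_zero, WithTop.nsmul_top_of_pos (pow_pos (Fact.out : p.Prime).pos k)]
  exact le_top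

theorem prW_eq_truncate {s t : ℕ} (ht : t ≤ s) (a : TruncatedWittVector p s K) :
    prW p K t ht a = TruncatedWittVector.truncate ht a := by
  ext i
  simp [prW]

theorem prW_VShift {s t : ℕ} (ht : t ≤ s) (x : TruncatedWittVector p (s - t) K) :
    prW p K t ht (VShift p K t s x) = 0 := by
  ext i
  simp [prW, VShift]

theorem VShift_mem_filW_iff {s t : ℕ} (ht : t ≤ s) {n : ℤ}
    {x : TruncatedWittVector p (s - t) K} :
    VShift p K t s x ∈ filW p K v s n ↔ x ∈ filW p K v (s - t) n := by
  simp only [mem_filW_iff, VShift, TruncatedWittVector.coeff_mk]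
  constructor
  · intro h i
    have hi := h ⟨i + t, by omega⟩
    simp only [Nat.add_sub_cancel, Nat.le_add_left, i.isLt, and_self, dite_true, Fin.eta] at hi
    rwa [show s - 1 - (i + t) = s - t - 1 - i by omega] at hi
  · intro h i
    split_ifs with hi
    · have := h ⟨i - t, hi.2⟩
      rwa [show s - t - 1 - (i - t) = s - 1 - (i : ℕ) by omega] at this
    · exact neg_le_pow_nsmul_zero _ _

theorem prW_mem_filWr_iff {s t : ℕ} (ht : t ≤ s) {n : ℕ} {y : TruncatedWittVector p s K} :
    prW p K t ht y ∈ filWr p K v t (s - t) n ↔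
      ∀ i : Fin s, (i : ℕ) < t →
        ((-(n : ℤ) : ℤ) : WithTop ℤ) ≤ p ^ (s - 1 - (i : ℕ)) • v (y.coeff i) := by
  have hp : 0 < p := (Fact.out : p.Prime).pos
  have key (i : Fin t) := neg_le_mul_nsmul_iff (pow_pos hp (s - t))
    (pow_pos hp (t - 1 - (i : ℕ))) n (v (y.coeff (Fin.castLE ht i)))
  simp only [← pow_add] at key
  simp only [filWr, mem_filW_iff, prW, TruncatedWittVector.coeff_mk, ← key]
  constructor
  · intro h i hi
    have := h ⟨i, hi⟩
    rwa [show s - t + (t - 1 - (i : ℕ)) = s - 1 - i by omega] at this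
  · intro h i
    rw [show s - t + (t - 1 - (i : ℕ)) = s - 1 - i by omega]
    exact h (Fin.castLE ht i) i.isLt

/-- Extension of a Witt vector of length `t` by zeros to one of length `s`: a set-theoretic
section of `prW`. -/
def extendZero {t : ℕ} (s : ℕ) (z : TruncatedWittVector p t K) : TruncatedWittVector p s K :=
  TruncatedWittVector.mk p fun i => if h : (i : ℕ) < t then z.coeff ⟨i, h⟩ else 0

omit [Fact p.Prime] in
theorem prW_extendZero {s t : ℕ} (ht : t ≤ s) (z : TruncatedWittVector p t K) :
    prW p K t ht (extendZero s z) = z := by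
  ext i
  simp [prW, extendZero]

theorem extendZero_mem_filW {s t : ℕ} (ht : t ≤ s) {n : ℕ} {z : TruncatedWittVector p t K}
    (hz : z ∈ filWr p K v t (s - t) n) : extendZero s z ∈ filW p K v s n := by
  rw [← prW_extendZero ht z, prW_mem_filWr_iff] at hz
  rw [mem_filW_iff]
  intro i
  by_cases hi : (i : ℕ) < t
  · exact hz i hi
  · simp only [extendZero, TruncatedWittVector.coeff_mk, hi, dite_false]
    exact neg_le_pow_nsmul_zero _ _

theorem TruncatedWittVector.coeff_add_of_disjoint {s : ℕ} (x y : TruncatedWittVector p s K)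
    (h : ∀ i, x.coeff i = 0 ∨ y.coeff i = 0) (i : Fin s) :
    (x + y).coeff i = x.coeff i + y.coeff i := by
  rw [← x.truncateFun_out, ← y.truncateFun_out, ← WittVector.truncateFun_add]
  simp only [WittVector.coeff_truncateFun]
  refine WittVector.coeff_add_of_disjoint _ _ _ fun j => ?_
  by_cases hj : j < s
  · simpa only [← TruncatedWittVector.coeff_out] using h ⟨j, hj⟩
  · left
    simp [TruncatedWittVector.out, hj]

theorem exists_eq_extendZero_add_VShift {s t : ℕ} (ht : t ≤ s)
    (y : TruncatedWittVector p s K) :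
    ∃ x : TruncatedWittVector p (s - t) K,
      y = extendZero s (prW p K t ht y) + VShift p K t s x ∧
        ∀ n, y ∈ filW p K v s n → x ∈ filW p K v (s - t) n := by
  refine ⟨TruncatedWittVector.mk p fun j => y.coeff ⟨j + t, by omega⟩, ?_, fun n hy => ?_⟩
  · ext i
    rw [TruncatedWittVector.coeff_add_of_disjoint]
    · by_cases hi : (i : ℕ) < t
      · simp [extendZero, prW, VShift, hi]
      · have h' : t ≤ (i : ℕ) ∧ (i : ℕ) - t < s - t := by omega
        simp [extendZero, VShift, hi, h', Nat.sub_add_cancel h'.1]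
    · intro j
      by_cases hj : (j : ℕ) < t
      · right
        simp [VShift, hj]
      · left
        simp [extendZero, hj]
  · rw [mem_filW_iff] at hy ⊢
    intro i
    have := hy ⟨i + t, by omega⟩
    rwa [show s - 1 - (i + t) = s - t - 1 - i by omega] at this

theorem prW_image_filW {s t : ℕ} (ht : t ≤ s) (n : ℕ) :
    prW p K t ht '' filW p K v s n = filWr p K v t (s - t) n := by
  ext z
  constructor
  · rintro ⟨y, hy, rfl⟩
    exact (prW_mem_filWr_iff ht).2 fun i _ => mem_filW_iff.1 hy i
  · exact fun hz => ⟨_, extendZero_mem_filW ht hz, prW_extendZero ht z⟩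

theorem prW_mem_filWr_iff_exists_sub_VShift_mem {s t : ℕ} (ht : t ≤ s) {m : ℕ} {n : ℤ}
    {y : TruncatedWittVector p s K} (hy : y ∈ filW p K v s n) :
    prW p K t ht y ∈ filWr p K v t (s - t) m ↔
      ∃ x ∈ filW p K v (s - t) n, y - VShift p K t s x ∈ filW p K v s m := by
  constructor
  · intro h
    obtain ⟨x, hxy, hx⟩ := exists_eq_extendZero_add_VShift (v := v) ht y
    refine ⟨x, hx n hy, ?_⟩
    rw [← eq_sub_iff_add_eq.2 hxy.symm]
    exact extendZero_mem_filW ht h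
  · rintro ⟨x, -, hxy⟩
    have h : prW p K t ht y = prW p K t ht (y - VShift p K t s x) := by
      rw [prW_eq_truncate, prW_eq_truncate, map_sub, ← prW_eq_truncate ht (VShift p K t s x),
        prW_VShift, sub_zero]
    rw [h, ← prW_image_filW ht]
    exact ⟨_, hxy, rfl⟩

end BrylinskiKato

/-- Lemma 1.9 of the paper.  Let `n ≥ 1` and `0 ≤ t ≤ s`.  Then
`V^t` maps `fil_n W_{s-t}(K)` into `fil_n W_s(K)`, `pr_t` maps `fil_n W_s(K)` onto
`fil^{(s-t)}_n W_t(K)`, and the induced sequence of abelian groups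
`0 → fil_n W_{s-t}/fil_{n-1} W_{s-t} → fil_n W_s/fil_{n-1} W_s →
fil^{(s-t)}_n W_t/fil^{(s-t)}_{n-1} W_t → 0` is exact (the exactness is expressed
elementwise below: injectivity of the induced `V^t`, exactness at the middle, and
surjectivity of `pr_t`).  Moreover the right-hand quotient equals
`fil_{n/p^{s-t}} W_t/fil_{n/p^{s-t}-1} W_t` if `p^{s-t} ∣ n` and is `0` otherwise. -/
theorem statement3 (hv : ∃ π : K, v π = 1) (s t n : ℕ) (ht : t ≤ s) (hn : 1 ≤ n) :
    (∀ x ∈ filW p K v (s - t) (n : ℤ), VShift p K t s x ∈ filW p K v s (n : ℤ)) ∧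
    (prW p K t ht '' (filW p K v s (n : ℤ)) = filWr p K v t (s - t) n) ∧
    (∀ x ∈ filW p K v (s - t) (n : ℤ),
        VShift p K t s x ∈ filW p K v s ((n : ℤ) - 1) →
        x ∈ filW p K v (s - t) ((n : ℤ) - 1)) ∧
    (∀ y ∈ filW p K v s (n : ℤ),
        (prW p K t ht y ∈ filWr p K v t (s - t) (n - 1) ↔
          ∃ x ∈ filW p K v (s - t) (n : ℤ),
            y - VShift p K t s x ∈ filW p K v s ((n : ℤ) - 1))) ∧
    (∀ z ∈ filWr p K v t (s - t) n, ∃ y ∈ filW p K v s (n : ℤ), prW p K t ht y = z) ∧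
    (p ^ (s - t) ∣ n →
        filWr p K v t (s - t) n = filW p K v t ((n / p ^ (s - t) : ℕ) : ℤ) ∧
        filWr p K v t (s - t) (n - 1)
          = filW p K v t (((n / p ^ (s - t) : ℕ) : ℤ) - 1)) ∧
    (¬ p ^ (s - t) ∣ n → filWr p K v t (s - t) n = filWr p K v t (s - t) (n - 1)) := by
  have hcast : (n : ℤ) - 1 = ((n - 1 : ℕ) : ℤ) := by omega
  refine ⟨fun x hx => (VShift_mem_filW_iff ht).2 hx, prW_image_filW ht n,
    fun x _ hx => (VShift_mem_filW_iff ht).1 hx, fun y hy => ?_, fun z hz => ?_,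
    fun hdvd => ⟨rfl, ?_⟩, fun hdvd => ?_⟩
  · rw [hcast]
    exact prW_mem_filWr_iff_exists_sub_VShift_mem ht hy
  · rwa [← prW_image_filW ht] at hz
  · have hdiv := Nat.succ_div_of_dvd (a := n - 1) (b := p ^ (s - t)) (by rwa [Nat.sub_add_cancel hn])
    rw [Nat.sub_add_cancel hn] at hdiv
    rw [filWr, hdiv, Nat.cast_succ, add_sub_cancel_right]
  · have hdiv := Nat.succ_div_of_not_dvd (a := n - 1) (b := p ^ (s - t)) (by rwa [Nat.sub_add_cancel hn])
    rw [Nat.sub_add_cancel hn] at hdiv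
    rw [filWr, filWr, hdiv]
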